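/- Let X be a pure d-dimensional finite simplicial complex with d ≥ 1, whose underlying weighted graph is a [−1,λ]-spectral expander, and let A be any abelian group. Then (X, A⁺) is a (1−λ)-coboundary expander in dimension 0: for every 0-cochain f ∈ C⁰(X,A⁺) = A^{X(0)}, one has ‖d₀f‖_ws ≥ (1−λ)·min_{a∈A} ‖f − a‖_ws, where a denotes the constant 0-cochain with value a, (d₀f)({u,v}) = f(u) − f(v) (up to sign), and ‖·‖_ws is the weighted support norm. -/

import Mathlib

open Finset

variable {V : Type} [DecidableEq V]

/-- A (finite) simplicial complex: a nonempty collection of finite subsets of the vertex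
type `V`, closed under taking subsets.  The empty face belongs to every complex. -/
def IsComplex (X : Finset (Finset V)) : Prop :=
  X.Nonempty ∧ ∀ s ∈ X, ∀ t ⊆ s, t ∈ X

/-- The faces of `X` having exactly `j` vertices, i.e. of dimension `j - 1`. -/
def faceSet (X : Finset (Finset V)) (j : ℕ) : Finset (Finset V) :=
  X.filter fun s => s.card = j

/-- `X` is pure of dimension `d`: every face is contained in a face with `d + 1` vertices. -/
def IsPure (X : Finset (Finset V)) (d : ℕ) : Prop :=
  ∀ s ∈ X, ∃ t ∈ X, s ⊆ t ∧ t.card = d + 1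

/-- The canonical weight of a face `x` of a pure `d`-dimensional complex `X`:
`w(x) = C(d+1, |x|)⁻¹ ⬝ |X(d)|⁻¹ ⬝ #{y ∈ X(d) : x ⊆ y}`. -/
noncomputable def wt (X : Finset (Finset V)) (d : ℕ) (x : Finset V) : ℝ :=
  ((d + 1).choose x.card : ℝ)⁻¹ * ((faceSet X (d + 1)).card : ℝ)⁻¹ *
    (((faceSet X (d + 1)).filter fun y => x ⊆ y).card : ℝ)


open scoped Classical

/-- If every eigenvalue of a weighted graph on the functions of weighted mean zero is at most `lam`,
then the Dirichlet form dominates `1 - lam` times the variance. -/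
theorem poincare_inequality_of_eigenvalues_le {ι : Type} [Fintype ι]
    (W : ι → ι → ℝ) (w : ι → ℝ) (lam : ℝ)
    (hsymm : ∀ u v, W u v = W v u) (hdeg : ∀ u, ∑ v, W u v = w u) (hpos : ∀ u, 0 < w u)
    (htot : ∑ u, w u = 1)
    (hspec : ∀ (μ : ℝ) (g : ι → ℝ), g ≠ 0 → ∑ u, w u * g u = 0 →
      (∀ u, ∑ v, W u v * g v = μ * (w u * g u)) → μ ≤ lam) (x : ι → ℝ) :
    (1 - lam) * (∑ u, w u * x u ^ 2 - (∑ u, w u * x u) ^ 2) ≤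
      ∑ u, w u * x u ^ 2 - ∑ u, ∑ v, W u v * (x u * x v) := by
  set s : ι → ℝ := fun u => √(w u)
  have hs0 : ∀ u, s u ≠ 0 := fun u => (Real.sqrt_pos.2 (hpos u)).ne'
  have hss : ∀ u, s u * s u = w u := fun u => Real.mul_self_sqrt (hpos u).le
  let B : Matrix ι ι ℝ := Matrix.of fun u v =>
    (if u = v then lam else 0) - W u v / (s u * s v) + (1 - lam) * (s u * s v)
  have mulVec_apply : ∀ (y : ι → ℝ) (u : ι), s u * B.mulVec (fun v => s v * y v) u =
      lam * (w u * y u) - ∑ v, W u v * y v + (1 - lam) * (w u * ∑ v, w v * y v) := by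
    intro y u
    have hterm : ∀ v, s u * (B u v * (s v * y v)) = (if u = v then lam * (w u * y u) else 0)
        - W u v * y v + (1 - lam) * (w u * (w v * y v)) := by
      intro v
      have := hs0 u
      have := hs0 v
      by_cases h : u = v
      · subst h
        simp only [B, Matrix.of_apply, if_true, ← hss]
        field_simp
      · simp only [B, Matrix.of_apply, if_neg h, ← hss]
        field_simp
        ring
    rw [Matrix.mulVec, dotProduct, mul_sum, sum_congr rfl fun v _ => hterm v]
    simp only [sum_add_distrib, sum_sub_distrib, sum_ite_eq, mem_univ, if_true, mul_sum]
  have hB : B.IsHermitian := by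
    ext u v
    simp only [B, Matrix.conjTranspose_apply, Matrix.of_apply, star_trivial, hsymm v u,
      mul_comm (s v), eq_comm (a := v)]
  have hpsd : B.PosSemidef := by
    rw [hB.posSemidef_iff_eigenvalues_nonneg]
    intro i
    set h : ι → ℝ := ⇑(hB.eigenvectorBasis i)
    have heig : B.mulVec h = hB.eigenvalues i • h := hB.mulVec_eigenvectorBasis i
    set ν := hB.eigenvalues i
    set g : ι → ℝ := fun u => h u / s u
    have hsg : (fun v => s v * g v) = h := funext fun v => mul_div_cancel₀ _ (hs0 v)
    have key : ∀ u, lam * (w u * g u) - ∑ v, W u v * g v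
        + (1 - lam) * (w u * ∑ v, w v * g v) = ν * (w u * g u) := by
      intro u
      rw [← mulVec_apply g u, hsg, heig, ← hsg, ← hss]
      simp only [Pi.smul_apply, smul_eq_mul]
      ring
    have hsumW : ∑ u, ∑ v, W u v * g v = ∑ v, w v * g v := by
      rw [sum_comm]
      refine sum_congr rfl fun v _ => ?_
      rw [← sum_mul, ← hdeg v]
      simp only [hsymm v]
    have hm : ν * ∑ u, w u * g u = 0 := by
      have hsum := sum_congr (rfl : (univ : Finset ι) = univ) fun u _ => key u
      rw [sum_add_distrib, sum_sub_distrib, ← mul_sum, ← mul_sum, ← mul_sum, ← sum_mul, htot,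
        hsumW] at hsum
      rw [← hsum]
      ring
    change 0 ≤ ν
    rcases mul_eq_zero.1 hm with hν | hm
    · exact hν.ge
    · have hg0 : g ≠ 0 := by
        intro h0
        have hzero : h = 0 := by
          rw [← hsg, h0]
          ext
          simp
        refine hB.eigenvectorBasis.orthonormal.ne_zero i ?_
        ext u
        exact congrFun hzero u
      have := hspec (lam - ν) g hg0 hm fun u => by
        have := key u
        rw [hm] at this
        linarith
      linarith
  have hnonneg : 0 ≤ ∑ u, (s u * x u) * B.mulVec (fun v => s v * x v) u := by
    simpa [dotProduct] using hpsd.dotProduct_mulVec_nonneg (fun v => s v * x v)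
  have hterm : ∀ u, (s u * x u) * B.mulVec (fun v => s v * x v) u =
      lam * (w u * x u ^ 2) - ∑ v, W u v * (x u * x v)
        + (1 - lam) * ((w u * x u) * ∑ v, w v * x v) := by
    intro u
    have hW : ∑ v, W u v * (x u * x v) = x u * ∑ v, W u v * x v := by
      rw [mul_sum]
      exact sum_congr rfl fun v _ => by ring
    rw [mul_right_comm, mulVec_apply, hW, mul_assoc (w u)]
    ring
  rw [sum_congr rfl fun u _ => hterm u, sum_add_distrib, sum_sub_distrib, ← mul_sum, ← mul_sum,
    ← sum_mul] at hnonneg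
  linarith

/-- Coboundary expansion in dimension `0` of a weighted graph satisfying a Poincaré inequality. -/
theorem exists_const_coboundary_expansion_of_poincare {ι A : Type} [Fintype ι]
    (W : ι → ι → ℝ) (w : ι → ℝ) (lam : ℝ)
    (hW : ∀ u v, 0 ≤ W u v) (hdeg : ∀ u, ∑ v, W u v = w u) (htot : ∑ u, w u = 1)
    (hpoincare : ∀ x : ι → ℝ, (1 - lam) * (∑ u, w u * x u ^ 2 - (∑ u, w u * x u) ^ 2) ≤
      ∑ u, w u * x u ^ 2 - ∑ u, ∑ v, W u v * (x u * x v))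
    (f : ι → A) :
    ∃ a : A, (1 - lam) * (∑ v, if f v ≠ a then w v else 0) ≤
      ∑ u, ∑ v, if f u ≠ f v then W u v else 0 := by
  have hw : ∀ u, 0 ≤ w u := fun u => hdeg u ▸ sum_nonneg fun v _ => hW u v
  have : Nonempty ι := by
    by_contra h
    rw [not_nonempty_iff] at h
    simp at htot
  let I : Finset A := univ.image f
  have hmem : ∀ v, f v ∈ I := fun v => mem_image_of_mem f (mem_univ v)
  let p : A → ℝ := fun a => ∑ v, w v * (if f v = a then 1 else 0)
  have hp : ∀ a, 0 ≤ p a := fun a =>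
    sum_nonneg fun v _ => mul_nonneg (hw v) (by split_ifs <;> norm_num)
  obtain ⟨a, -, hmax⟩ := I.exists_max_image p (univ_nonempty.image f)
  have hpsum : ∑ b ∈ I, p b = 1 := by
    rw [sum_comm]
    refine Eq.trans (sum_congr rfl fun v _ => ?_) htot
    rw [← mul_sum, sum_ite_eq, if_pos (hmem v), mul_one]
  have hsq : ∑ b ∈ I, p b ^ 2 ≤ p a := by
    calc ∑ b ∈ I, p b ^ 2 ≤ ∑ b ∈ I, p a * p b := sum_le_sum fun b hb => by
          rw [sq]
          exact mul_le_mul_of_nonneg_right (hmax b hb) (hp b)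
      _ = p a := by rw [← mul_sum, hpsum, mul_one]
  have hdist : (∑ v, if f v ≠ a then w v else 0) = 1 - p a := by
    rw [← htot, ← sum_sub_distrib]
    refine sum_congr rfl fun v _ => ?_
    by_cases h : f v = a <;> simp [h]
  refine ⟨a, ?_⟩
  rcases le_total lam 1 with hlam | hlam
  · have hsum := sum_le_sum fun b (_ : b ∈ I) => hpoincare fun v => if f v = b then 1 else 0
    simp only [ite_pow, one_pow, ne_eq, OfNat.ofNat_ne_zero, not_false_eq_true, zero_pow] at hsum
    rw [← mul_sum, sum_sub_distrib, sum_sub_distrib] at hsum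
    have hcob : (∑ u, ∑ v, if f u ≠ f v then W u v else 0) =
        1 - ∑ b ∈ I, ∑ u, ∑ v,
          W u v * ((if f u = b then 1 else 0) * (if f v = b then 1 else 0)) := by
      rw [sum_comm (s := I)]
      refine Eq.trans ?_ (congrArg (· - _) htot)
      rw [← sum_sub_distrib]
      refine sum_congr rfl fun u _ => ?_
      rw [sum_comm, ← hdeg u, ← sum_sub_distrib]
      refine sum_congr rfl fun v _ => ?_
      by_cases h : f u = f v
      · simp [h, hmem]
      · simp [h, hmem]
    rw [hdist, hcob]
    change (1 - lam) * (∑ b ∈ I, p b - ∑ b ∈ I, p b ^ 2) ≤ ∑ b ∈ I, p b - _ at hsum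
    rw [hpsum] at hsum
    refine le_trans (mul_le_mul_of_nonneg_left ?_ (by linarith)) hsum
    linarith
  · refine le_trans (mul_nonpos_of_nonpos_of_nonneg (by linarith) ?_) ?_
    · exact sum_nonneg fun v _ => by split_ifs <;> simp [hw]
    · exact sum_nonneg fun u _ => sum_nonneg fun v _ => by split_ifs <;> simp [hW]

theorem mem_faceSet {V : Type} {X : Finset (Finset V)} {j : ℕ} {s : Finset V} :
    s ∈ faceSet X j ↔ s ∈ X ∧ s.card = j :=
  mem_filter

theorem ne_of_pair_mem_faceSet {X : Finset (Finset V)} {u v : V}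
    (h : ({v, u} : Finset V) ∈ faceSet X 2) : v ≠ u := by
  rintro rfl
  simp [mem_faceSet] at h

/-- Sums over the edges containing `v`, written as sums over the neighbours of `v`. -/
theorem sum_edges_containing [Fintype V] (X : Finset (Finset V)) (v : V)
    (F : Finset V → ℝ) (G : V → ℝ) :
    ∑ e ∈ (faceSet X 2).filter (fun e => v ∈ e), F e * ∑ u ∈ e.erase v, G u =
      ∑ u, if ({v, u} : Finset V) ∈ faceSet X 2 then F {v, u} * G u else 0 := by
  rw [← sum_filter]
  symm
  refine sum_bij (fun u _ => {v, u}) ?_ ?_ ?_ ?_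
  · intro u hu
    simpa using hu
  · intro u hu u' hu' h
    simp only [mem_filter, mem_univ, true_and] at hu hu'
    have : u ∈ ({v, u'} : Finset V) := h ▸ by simp
    simp only [mem_insert, mem_singleton] at this
    exact this.resolve_left (ne_of_pair_mem_faceSet hu).symm
  · intro e he
    rw [mem_filter, mem_faceSet] at he
    obtain ⟨u, hu⟩ := card_eq_one.1 (show (e.erase v).card = 1 by
      rw [card_erase_of_mem he.2, he.1.2])
    have hvu : {v, u} = e := by rw [← insert_erase he.2, hu]
    exact ⟨u, by simp [hvu, mem_faceSet, he.1], hvu⟩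
  · intro u hu
    simp only [mem_filter, mem_univ, true_and] at hu
    rw [erase_insert (by simpa using ne_of_pair_mem_faceSet hu), sum_singleton]

theorem sum_neighbors_eq_two_mul_sum_edges [Fintype V] (X : Finset (Finset V))
    (F : Finset V → ℝ) :
    ∑ v, ∑ u, (if ({v, u} : Finset V) ∈ faceSet X 2 then F {v, u} else 0) =
      2 * ∑ e ∈ faceSet X 2, F e := by
  have hv : ∀ v, ∑ u, (if ({v, u} : Finset V) ∈ faceSet X 2 then F {v, u} else 0) =
      ∑ e ∈ faceSet X 2, if v ∈ e then F e else 0 := by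
    intro v
    have h := sum_edges_containing X v F fun _ => 1
    simp only [mul_one] at h
    rw [← h, ← sum_filter]
    refine sum_congr rfl fun e he => ?_
    rw [mem_filter, mem_faceSet] at he
    simp [card_erase_of_mem he.2, he.1.2]
  rw [sum_congr rfl fun v _ => hv v, sum_comm, mul_sum]
  refine sum_congr rfl fun e he => ?_
  rw [sum_ite_mem, univ_inter, sum_const, (mem_faceSet.1 he).2, nsmul_eq_mul, Nat.cast_ofNat]

theorem wt_nonneg (X : Finset (Finset V)) (d : ℕ) (x : Finset V) : 0 ≤ wt X d x := by
  unfold wt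
  positivity

theorem wt_singleton_pos {X : Finset (Finset V)} {d : ℕ} (hpure : IsPure X d) {v : V}
    (hv : ({v} : Finset V) ∈ X) : 0 < wt X d {v} := by
  obtain ⟨t, ht, hvt, hcard⟩ := hpure _ hv
  have htop : t ∈ faceSet X (d + 1) := mem_faceSet.2 ⟨ht, hcard⟩
  have h1 : 0 < (faceSet X (d + 1)).card := card_pos.2 ⟨t, htop⟩
  have h2 : 0 < ((faceSet X (d + 1)).filter fun y => {v} ⊆ y).card :=
    card_pos.2 ⟨t, mem_filter.2 ⟨htop, hvt⟩⟩
  have h3 : 0 < (d + 1).choose ({v} : Finset V).card :=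
    Nat.choose_pos (by simp)
  unfold wt
  positivity

theorem wt_singleton_eq_zero {X : Finset (Finset V)} (d : ℕ) (hX : IsComplex X) {v : V}
    (hv : ({v} : Finset V) ∉ X) : wt X d {v} = 0 := by
  have h : (faceSet X (d + 1)).filter (fun y => {v} ⊆ y) = ∅ :=
    filter_eq_empty_iff.2 fun y hy hvy => hv (hX.2 y (mem_faceSet.1 hy).1 _ hvy)
  rw [wt, h, card_empty, Nat.cast_zero, mul_zero]

theorem sum_wt_singleton [Fintype V] {X : Finset (Finset V)} {d : ℕ} (hX : IsComplex X)
    (hpure : IsPure X d) : ∑ v, wt X d {v} = 1 := by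
  obtain ⟨s, hs⟩ := hX.1
  obtain ⟨t, ht, -, hcard⟩ := hpure s hs
  have h1 : ((faceSet X (d + 1)).card : ℝ) ≠ 0 :=
    Nat.cast_ne_zero.2 (card_pos.2 ⟨t, mem_faceSet.2 ⟨ht, hcard⟩⟩).ne'
  have hcount : ∑ v, ((((faceSet X (d + 1)).filter fun y => {v} ⊆ y).card : ℕ) : ℝ) =
      (faceSet X (d + 1)).card * (d + 1 : ℝ) := by
    simp only [singleton_subset_iff, card_filter, Nat.cast_sum, Nat.cast_ite, Nat.cast_one,
      Nat.cast_zero]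
    rw [sum_comm, ← nsmul_eq_mul]
    refine sum_eq_card_nsmul fun y hy => ?_
    simp [(mem_faceSet.1 hy).2]
  have h2 : (d + 1 : ℝ) ≠ 0 := by positivity
  simp only [wt, card_singleton, Nat.choose_one_right]
  rw [← mul_sum, hcount]
  push_cast
  field_simp

theorem sum_wt_neighbors [Fintype V] {X : Finset (Finset V)} {d : ℕ} (hd : 1 ≤ d)
    (hX : IsComplex X) (v : V) :
    ∑ u, (if ({v, u} : Finset V) ∈ faceSet X 2 then wt X d {v, u} else 0) =
      2 * wt X d {v} := by
  have hcount : ∑ u, (if ({v, u} : Finset V) ∈ faceSet X 2 then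
      (((faceSet X (d + 1)).filter fun y => {v, u} ⊆ y).card : ℝ) else 0) =
      d * (((faceSet X (d + 1)).filter fun y => {v} ⊆ y).card : ℝ) := by
    have hterm : ∀ u, (if ({v, u} : Finset V) ∈ faceSet X 2 then
        (((faceSet X (d + 1)).filter fun y => {v, u} ⊆ y).card : ℝ) else 0) =
        ∑ y ∈ (faceSet X (d + 1)).filter (fun y => {v} ⊆ y),
          if u ∈ y.erase v then 1 else 0 := by
      intro u
      rw [sum_filter, card_filter]
      push_cast
      split_ifs with h
      · have := ne_of_pair_mem_faceSet h
        refine sum_congr rfl fun y _ => ?_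
        by_cases hv : v ∈ y <;> simp [insert_subset_iff, hv, this.symm]
      · refine (sum_eq_zero fun y hy => ?_).symm
        split_ifs with hv hu <;> try rfl
        rw [mem_erase] at hu
        refine absurd (mem_faceSet.2 ⟨hX.2 y (mem_faceSet.1 hy).1 _ ?_, card_pair hu.1.symm⟩) h
        exact insert_subset (singleton_subset_iff.1 hv) (singleton_subset_iff.2 hu.2)
    rw [sum_congr rfl fun u _ => hterm u, sum_comm, mul_comm, ← nsmul_eq_mul]
    refine sum_eq_card_nsmul fun y hy => ?_
    rw [mem_filter, mem_faceSet, singleton_subset_iff] at hy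
    rw [sum_ite_mem, univ_inter, sum_const, card_erase_of_mem hy.2, hy.1.2]
    simp
  have hchoose : ((d + 1).choose 2 : ℝ) = (d + 1) * d / 2 := by
    rw [Nat.cast_choose_two]
    push_cast
    ring
  have hd0 : (d : ℝ) ≠ 0 := by positivity
  have hd1 : (d + 1 : ℝ) ≠ 0 := by positivity
  have hterm : ∀ u, (if ({v, u} : Finset V) ∈ faceSet X 2 then wt X d {v, u} else 0) =
      ((d + 1) * d / 2 : ℝ)⁻¹ * ((faceSet X (d + 1)).card : ℝ)⁻¹ *
      (if ({v, u} : Finset V) ∈ faceSet X 2 then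
        (((faceSet X (d + 1)).filter fun y => {v, u} ⊆ y).card : ℝ) else 0) := by
    intro u
    split_ifs with h
    · rw [wt, (mem_faceSet.1 h).2, hchoose]
    · rw [mul_zero]
  rw [sum_congr rfl fun u _ => hterm u, ← mul_sum, hcount, wt, card_singleton,
    Nat.choose_one_right]
  push_cast
  field_simp

/-- Let `X` be a pure `d`-dimensional finite complex (`d ≥ 1`) whose
underlying weighted graph is a `[-1, λ]`-spectral expander: every eigenvalue `μ` of the
weighted adjacency operator `(A g)(v) = ∑_{e ∋ v} (w(e)/(2 w(v))) g(e - v)` on the space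
of functions on the vertices with `∑_v w(v) g(v) = 0` lies in `[-1, λ]`.  Then for every
abelian group `A`, the constant augmented sheaf `A⁺` is a `(1-λ)`-coboundary expander in
dimension `0`: for every `f ∈ C⁰(X, A⁺) = A^{X(0)}` there is a constant `a ∈ A` with
`‖d₀ f‖_ws ≥ (1-λ) ⬝ ‖f - a‖_ws`, where `(d₀ f)({u,v}) = f(u) - f(v)` (up to sign), so
that `‖d₀ f‖_ws ≥ (1-λ) ⬝ min_{a ∈ A} ‖f - a‖_ws`. -/
theorem constant_sheaf_coboundary_expansion [Fintype V]
    (X : Finset (Finset V)) (d : ℕ) (hd : 1 ≤ d)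
    (hX : IsComplex X) (hpure : IsPure X d)
    (lam : ℝ)
    (hspec : ∀ (μ : ℝ) (g : V → ℝ),
      (∃ v : V, ({v} : Finset V) ∈ X ∧ g v ≠ 0) →
      (∑ v ∈ Finset.univ.filter (fun v : V => ({v} : Finset V) ∈ X),
        wt X d {v} * g v = 0) →
      (∀ v : V, ({v} : Finset V) ∈ X →
        ∑ e ∈ (faceSet X 2).filter (fun e => v ∈ e),
          (wt X d e / (2 * wt X d {v})) * (∑ u ∈ e.erase v, g u) = μ * g v) →
      μ ∈ Set.Icc (-1 : ℝ) lam)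
    (A : Type) [AddCommGroup A] (f : V → A) :
    ∃ a : A,
      (1 - lam) * (∑ v ∈ Finset.univ.filter (fun v : V => ({v} : Finset V) ∈ X),
          if f v ≠ a then wt X d {v} else 0)
        ≤ ∑ e ∈ faceSet X 2,
            if ∃ u ∈ e, ∃ v' ∈ e, f u ≠ f v' then wt X d e else 0 := by
  have hedge : ∀ {v u : V}, ({v, u} : Finset V) ∈ faceSet X 2 →
      ({v} : Finset V) ∈ X ∧ ({u} : Finset V) ∈ X := fun h =>
    ⟨hX.2 _ (mem_faceSet.1 h).1 _ (by simp), hX.2 _ (mem_faceSet.1 h).1 _ (by simp)⟩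
  let S : Type := {v : V // ({v} : Finset V) ∈ X}
  have sum_filter_vertices : ∀ F : V → ℝ,
      ∑ v ∈ univ.filter (fun v : V => ({v} : Finset V) ∈ X), F v = ∑ v : S, F v.1 :=
    fun F => sum_subtype _ (by simp) F
  have sum_vertices : ∀ F : V → ℝ, (∀ v, ({v} : Finset V) ∉ X → F v = 0) →
      ∑ v : S, F v.1 = ∑ v, F v := by
    intro F hF
    rw [← sum_filter_vertices]
    exact sum_filter_of_ne fun v _ hv => by_contra fun h => hv (hF v h)
  let W : V → V → ℝ := fun v u =>
    if ({v, u} : Finset V) ∈ faceSet X 2 then wt X d {v, u} / 2 else 0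
  have hW0 : ∀ v u, ({u} : Finset V) ∉ X → W v u = 0 := fun v u hu =>
    if_neg fun h => hu (hedge h).2
  have hWsymm : ∀ v u, W v u = W u v := fun v u => by simp only [W, pair_comm]
  have hWnonneg : ∀ v u, 0 ≤ W v u := fun v u => by
    simp only [W]
    split_ifs
    · exact div_nonneg (wt_nonneg _ _ _) zero_le_two
    · exact le_rfl
  have hdeg : ∀ v : S, ∑ u : S, W v.1 u.1 = wt X d {v.1} := by
    intro v
    rw [sum_vertices (fun u => W v.1 u) (hW0 v.1)]
    have h := sum_wt_neighbors hd hX v.1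
    rw [← mul_right_inj' (two_ne_zero' ℝ), ← h, mul_sum]
    refine sum_congr rfl fun u _ => ?_
    simp only [W]
    split_ifs <;> ring
  have htot : ∑ v : S, wt X d {v.1} = 1 := by
    rw [sum_vertices (fun v => wt X d {v}) fun v hv => wt_singleton_eq_zero d hX hv,
      sum_wt_singleton hX hpure]
  have hpos : ∀ v : S, 0 < wt X d {v.1} := fun v => wt_singleton_pos hpure v.2
  have heigenvalue : ∀ (μ : ℝ) (g : S → ℝ), g ≠ 0 → ∑ v : S, wt X d {v.1} * g v = 0 →
      (∀ v : S, ∑ u : S, W v.1 u.1 * g u = μ * (wt X d {v.1} * g v)) → μ ≤ lam := by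
    intro μ g hg hmean heig
    let G : V → ℝ := fun v => if h : ({v} : Finset V) ∈ X then g ⟨v, h⟩ else 0
    have hG : ∀ v : S, G v.1 = g v := fun v => dif_pos v.2
    obtain ⟨v₀, hv₀⟩ := Function.ne_iff.1 hg
    refine (hspec μ G ⟨v₀.1, v₀.2, by rwa [hG]⟩ ?_ ?_).2
    · rw [sum_filter_vertices, ← hmean]
      simp only [hG]
    · intro v hv
      have h := heig ⟨v, hv⟩
      simp only [← hG] at h
      rw [sum_vertices (fun u => W v u * G u) fun u hu => by simp [hW0 v u hu]] at h
      rw [sum_edges_containing X v (fun e => wt X d e / (2 * wt X d {v})) G]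
      have hw : wt X d {v} ≠ 0 := (hpos ⟨v, hv⟩).ne'
      rw [← mul_right_inj' hw, mul_left_comm _ μ, ← h, mul_sum]
      refine sum_congr rfl fun u _ => ?_
      simp only [W]
      split_ifs
      · field_simp
      · simp
  obtain ⟨a, ha⟩ := exists_const_coboundary_expansion_of_poincare
    (fun v u : S => W v.1 u.1) (fun v : S => wt X d {v.1}) lam (fun v u => hWnonneg _ _) hdeg htot
    (poincare_inequality_of_eigenvalues_le _ _ lam (fun v u => hWsymm _ _) hdeg hpos htot
      heigenvalue)
    (fun v : S => f v.1)
  refine ⟨a, ?_⟩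
  rw [sum_filter_vertices]
  refine ha.trans_eq ?_
  set F : Finset V → ℝ := fun e => if ∃ u ∈ e, ∃ v' ∈ e, f u ≠ f v' then wt X d e else 0
  have hF : ∀ v u, (if f v ≠ f u then W v u else 0) =
      (if ({v, u} : Finset V) ∈ faceSet X 2 then F {v, u} else 0) / 2 := by
    intro v u
    by_cases h : f v = f u
    · simp [F, h]
    · simp [F, W, h, ite_div]
  have hinner : ∀ v, ∑ u : S, (if f v ≠ f u.1 then W v u.1 else 0) =
      ∑ u, if f v ≠ f u then W v u else 0 := fun v =>
    sum_vertices (fun u => if f v ≠ f u then W v u else 0) fun u hu => by simp [hW0 v u hu]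
  rw [sum_congr rfl fun v _ => hinner v.1,
    sum_vertices (fun v => ∑ u, if f v ≠ f u then W v u else 0) fun v hv =>
      sum_eq_zero fun u _ => by simp [hWsymm v u, hW0 u v hv]]
  simp only [hF]
  simp only [← sum_div]
  rw [sum_neighbors_eq_two_mul_sum_edges]
  ring
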